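/- Let (H,A) be an abelian weak matched pair. Then the coproduct Δ on A#H is multiplicative: Δ((x#h)(y#g)) = Δ(x#h)Δ(y#g) in (A#H)⊗(A#H), for all x,y ∈ A and h,g ∈ H. -/

import Mathlib

open TensorProduct

noncomputable section

namespace WeakSmash

variable (k : Type*) [Field k]

/-- A weak bialgebra structure on the `k`-algebra `H`. -/
structure WeakBialgebra (H : Type*) [Ring H] [Algebra k H] where
  comul : H →ₗ[k] H ⊗[k] H
  counit : H →ₗ[k] k
  coassoc : ∀ h : H,
    (TensorProduct.assoc k H H H) ((LinearMap.rTensor H comul) (comul h)) =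
      (LinearMap.lTensor H comul) (comul h)
  counit_comul : ∀ h : H,
    (TensorProduct.lid k H) ((LinearMap.rTensor H counit) (comul h)) = h
  comul_counit : ∀ h : H,
    (TensorProduct.rid k H) ((LinearMap.lTensor H counit) (comul h)) = h
  comul_mul : ∀ h g : H, comul (h * g) = comul h * comul g
  counit_weak : ∀ h g l : H,
    counit (h * g * l) =
      LinearMap.mul' k k
        ((TensorProduct.map (counit ∘ₗ LinearMap.mulLeft k h)
            (counit ∘ₗ LinearMap.mulRight k l)) (comul g))
  counit_weak' : ∀ h g l : H,
    counit (h * g * l) =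
      LinearMap.mul' k k
        ((TensorProduct.map (counit ∘ₗ LinearMap.mulLeft k h)
            (counit ∘ₗ LinearMap.mulRight k l)) ((TensorProduct.comm k H H) (comul g)))
  comul_one_left :
    ((TensorProduct.assoc k H H H) (comul 1 ⊗ₜ[k] (1 : H))) * ((1 : H) ⊗ₜ[k] comul 1) =
      (LinearMap.lTensor H comul) (comul 1)
  comul_one_right :
    ((1 : H) ⊗ₜ[k] comul 1) * ((TensorProduct.assoc k H H H) (comul 1 ⊗ₜ[k] (1 : H))) =
      (LinearMap.lTensor H comul) (comul 1)

variable {k}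

namespace WeakBialgebra

variable {H : Type*} [Ring H] [Algebra k H]

/-- The target counital map `εt h = ε(1₁ h) 1₂`. -/
def εt (W : WeakBialgebra k H) : H →ₗ[k] H :=
  (TensorProduct.lid k H).toLinearMap ∘ₗ LinearMap.rTensor H W.counit ∘ₗ
    LinearMap.mulLeft k (W.comul 1) ∘ₗ (TensorProduct.mk k H H).flip 1

/-- The source counital map `εs h = 1₁ ε(h 1₂)`. -/
def εs (W : WeakBialgebra k H) : H →ₗ[k] H :=
  (TensorProduct.rid k H).toLinearMap ∘ₗ LinearMap.lTensor H W.counit ∘ₗ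
    LinearMap.mulRight k (W.comul 1) ∘ₗ TensorProduct.mk k H H 1

/-- Cocommutativity of a weak bialgebra. -/
def Cocomm (W : WeakBialgebra k H) : Prop :=
  ∀ h : H, (TensorProduct.comm k H H) (W.comul h) = W.comul h

/-- `S` is an antipode for `W`, making it a weak Hopf algebra. -/
structure IsAntipode (W : WeakBialgebra k H) (S : H →ₗ[k] H) : Prop where
  mul_antipode : ∀ h : H,
    LinearMap.mul' k H ((LinearMap.lTensor H S) (W.comul h)) = W.εt h
  antipode_mul : ∀ h : H,
    LinearMap.mul' k H ((LinearMap.rTensor H S) (W.comul h)) = W.εs h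
  antipode_mid : ∀ h : H,
    LinearMap.mul' k H
      ((TensorProduct.map S (LinearMap.mul' k H ∘ₗ LinearMap.lTensor H S))
        ((LinearMap.lTensor H W.comul) (W.comul h))) = S h

/-- `α` is a left integral: `h α = εt(h) α`. -/
def IsLeftIntegral (W : WeakBialgebra k H) (α : H) : Prop :=
  ∀ h : H, h * α = W.εt h * α

end WeakBialgebra

section MatchedPair

variable (k)
variable {H A : Type*} [Ring H] [Algebra k H] [Ring A] [Algebra k A]

/-- `A` is a left `H`-module algebra via the action `act`. -/
structure IsModuleAlgebra (WH : WeakBialgebra k H) (act : H →ₗ[k] A →ₗ[k] A) : Prop where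
  one_act : ∀ a : A, act 1 a = a
  act_mul : ∀ (h : H) (a b : A),
    act h (a * b) =
      LinearMap.mul' k A ((TensorProduct.map (act.flip a) (act.flip b)) (WH.comul h))
  act_act : ∀ (h g : H) (a : A), act h (act g a) = act (h * g) a
  act_unit : ∀ h : H, act h 1 = act (WH.εt h) 1

/-- The map `h ↦ ε(h⁰) h¹`. -/
def coactCounit (WH : WeakBialgebra k H) (coact : H →ₗ[k] H ⊗[k] A) : H →ₗ[k] A :=
  (TensorProduct.lid k A).toLinearMap ∘ₗ LinearMap.rTensor A WH.counit ∘ₗ coact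

/-- `H` is a right `A`-comodule coalgebra via the coaction `coact`. -/
structure IsComoduleCoalgebra (WH : WeakBialgebra k H) (WA : WeakBialgebra k A)
    (coact : H →ₗ[k] H ⊗[k] A) : Prop where
  counit_coact : ∀ h : H,
    (TensorProduct.rid k H) ((LinearMap.lTensor H WA.counit) (coact h)) = h
  comul_coact : ∀ h : H,
    (LinearMap.rTensor A WH.comul) (coact h) =
      (LinearMap.lTensor (H ⊗[k] H) (LinearMap.mul' k A))
        ((TensorProduct.tensorTensorTensorComm k H A H A)
          ((TensorProduct.map coact coact) (WH.comul h)))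
  coact_coact : ∀ h : H,
    (TensorProduct.assoc k H A A) ((LinearMap.rTensor A coact) (coact h)) =
      (LinearMap.lTensor H WA.comul) (coact h)
  coact_counit : ∀ h : H,
    coactCounit k WH coact h = WA.εs (coactCounit k WH coact h)

/-- The map `(h₁ ⊗ h₂) ⊗ (x₁ ⊗ x₂) ↦ (h₁⁰ · x₁) ⊗ (h₁¹ (h₂ · x₂))`. -/
def pairMapA (act : H →ₗ[k] A →ₗ[k] A) (coact : H →ₗ[k] H ⊗[k] A) :
    (H ⊗[k] H) ⊗[k] (A ⊗[k] A) →ₗ[k] A ⊗[k] A :=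
  LinearMap.lTensor A (LinearMap.mul' k A) ∘ₗ
  (TensorProduct.assoc k A A A).toLinearMap ∘ₗ
  LinearMap.rTensor A
    (LinearMap.rTensor A (TensorProduct.lift act) ∘ₗ
      (TensorProduct.assoc k H A A).symm.toLinearMap ∘ₗ
      LinearMap.lTensor H (TensorProduct.comm k A A).toLinearMap ∘ₗ
      (TensorProduct.assoc k H A A).toLinearMap) ∘ₗ
  TensorProduct.map (LinearMap.rTensor A coact) (TensorProduct.lift act) ∘ₗ
  (TensorProduct.tensorTensorTensorComm k H H A A).toLinearMap

/-- The map `(h₁ ⊗ h₂) ⊗ (g⁰ ⊗ g¹) ↦ (h₁⁰ g⁰) ⊗ (h₁¹ (h₂ · g¹))`. -/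
def pairMapH (act : H →ₗ[k] A →ₗ[k] A) (coact : H →ₗ[k] H ⊗[k] A) :
    (H ⊗[k] H) ⊗[k] (H ⊗[k] A) →ₗ[k] H ⊗[k] A :=
  LinearMap.lTensor H (LinearMap.mul' k A) ∘ₗ
  (TensorProduct.assoc k H A A).toLinearMap ∘ₗ
  LinearMap.rTensor A
    (LinearMap.rTensor A (LinearMap.mul' k H) ∘ₗ
      (TensorProduct.assoc k H H A).symm.toLinearMap ∘ₗ
      LinearMap.lTensor H (TensorProduct.comm k A H).toLinearMap ∘ₗ
      (TensorProduct.assoc k H A H).toLinearMap) ∘ₗ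
  TensorProduct.map (LinearMap.rTensor H coact) (TensorProduct.lift act) ∘ₗ
  (TensorProduct.tensorTensorTensorComm k H H H A).toLinearMap

/-- The iterated comultiplication `h ↦ h₁ ⊗ (h₂ ⊗ h₃)`. -/
def twoComul (WH : WeakBialgebra k H) : H →ₗ[k] H ⊗[k] (H ⊗[k] H) :=
  LinearMap.lTensor H WH.comul ∘ₗ WH.comul

/-- The iterated comultiplication `h ↦ h₁ ⊗ (h₂ ⊗ (h₃ ⊗ h₄))`. -/
def threeComul (WH : WeakBialgebra k H) : H →ₗ[k] H ⊗[k] (H ⊗[k] (H ⊗[k] H)) :=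
  LinearMap.lTensor H (LinearMap.lTensor H WH.comul) ∘ₗ LinearMap.lTensor H WH.comul ∘ₗ WH.comul

/-- Left-hand side of the matched pair condition (iii):
`(h₁·x)₁ ⊗ (h₂ g)⁰ ⊗ (h₁·x)₂ (h₂ g)¹`. -/
def mpLHS (WH : WeakBialgebra k H) (WA : WeakBialgebra k A)
    (act : H →ₗ[k] A →ₗ[k] A) (coact : H →ₗ[k] H ⊗[k] A) (h g : H) (x : A) :
    (A ⊗[k] H) ⊗[k] A :=
  LinearMap.lTensor (A ⊗[k] H) (LinearMap.mul' k A)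
    ((TensorProduct.tensorTensorTensorComm k A A H A)
      ((TensorProduct.map (WA.comul ∘ₗ act.flip x) (coact ∘ₗ LinearMap.mulRight k g))
        (WH.comul h)))

/-- Right-hand side of the matched pair condition (iii):
`(h₁⁰ · x₁) ⊗ (h₃⁰ g⁰) ⊗ (h₁¹ (h₂ · x₂) h₃¹ (h₄ · g¹))`. -/
def mpRHS (WH : WeakBialgebra k H) (WA : WeakBialgebra k A)
    (act : H →ₗ[k] A →ₗ[k] A) (coact : H →ₗ[k] H ⊗[k] A) (h g : H) (x : A) :
    (A ⊗[k] H) ⊗[k] A :=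
  LinearMap.lTensor (A ⊗[k] H) (LinearMap.mul' k A)
    ((TensorProduct.tensorTensorTensorComm k A A H A)
      ((TensorProduct.map
          (pairMapA k act coact ∘ₗ
            (TensorProduct.mk k (H ⊗[k] H) (A ⊗[k] A)).flip (WA.comul x))
          (pairMapH k act coact ∘ₗ
            (TensorProduct.mk k (H ⊗[k] H) (H ⊗[k] A)).flip (coact g)))
        ((TensorProduct.assoc k H H (H ⊗[k] H)).symm (threeComul k WH h))))

/-- `(H, A)` is a weak matched pair. -/
structure IsWeakMatchedPair (WH : WeakBialgebra k H) (WA : WeakBialgebra k A)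
    (act : H →ₗ[k] A →ₗ[k] A) (coact : H →ₗ[k] H ⊗[k] A) : Prop where
  moduleAlgebra : IsModuleAlgebra k WH act
  comoduleCoalgebra : IsComoduleCoalgebra k WH WA coact
  cond3 : ∀ (h g : H) (x : A),
    mpLHS k WH WA act coact h g x = mpRHS k WH WA act coact h g x
  cond4 : ∀ (h : H) (x : A), WA.εs (act h x) = WA.εs (act h 1) * WA.εs x
  cond5 :
    (LinearMap.rTensor H coact) (WH.comul 1) =
      (TensorProduct.map (LinearMap.lTensor H (coactCounit k WH coact))
          (LinearMap.mul' k H))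
        ((TensorProduct.tensorTensorTensorComm k H H H H)
          (WH.comul 1 ⊗ₜ[k] WH.comul 1))

/-- `(H, A)` is a compatible (abelian) weak matched pair. -/
structure IsCompatiblePair (WH : WeakBialgebra k H) (WA : WeakBialgebra k A)
    (act : H →ₗ[k] A →ₗ[k] A) (coact : H →ₗ[k] H ⊗[k] A) : Prop where
  pair : IsWeakMatchedPair k WH WA act coact
  cocomm : WH.Cocomm
  comm : ∀ a b : A, a * b = b * a
  compat1 : ∀ h : H,
    act h 1 =
      (TensorProduct.rid k A)
        ((TensorProduct.map (TensorProduct.lift act)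
            (WA.counit ∘ₗ TensorProduct.lift act))
          ((TensorProduct.tensorTensorTensorComm k H H A A)
            (WH.comul h ⊗ₜ[k] WA.comul 1)))
  compat2 : ∀ h g : H,
    (TensorProduct.map (act h) (act g)) (WA.comul 1) =
      (TensorProduct.map (LinearMap.mulLeft k (act h 1))
        (LinearMap.mulLeft k (act g 1))) (WA.comul 1)

/-- The smash product multiplication on `A ⊗ H`:
`(x ⊗ h) (y ⊗ g) = x (h₁ · y) ⊗ h₂ g`. -/
def smashMul (WH : WeakBialgebra k H) (act : H →ₗ[k] A →ₗ[k] A) :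
    (A ⊗[k] H) ⊗[k] (A ⊗[k] H) →ₗ[k] A ⊗[k] H :=
  LinearMap.rTensor H (LinearMap.mul' k A) ∘ₗ
  (TensorProduct.assoc k A A H).symm.toLinearMap ∘ₗ
  LinearMap.lTensor A
    (TensorProduct.map (TensorProduct.lift act) (LinearMap.mul' k H) ∘ₗ
      (TensorProduct.tensorTensorTensorComm k H H A H).toLinearMap) ∘ₗ
  (TensorProduct.assoc k A (H ⊗[k] H) (A ⊗[k] H)).toLinearMap ∘ₗ
  LinearMap.rTensor (A ⊗[k] H) (LinearMap.lTensor A WH.comul)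

/-- The smash coproduct on `A ⊗ H`:
`Δ(x ⊗ h) = (x₁ ⊗ h₁⁰) ⊗ (x₂ h₁¹ ⊗ h₂)`. -/
def smashComul (WH : WeakBialgebra k H) (WA : WeakBialgebra k A)
    (coact : H →ₗ[k] H ⊗[k] A) :
    A ⊗[k] H →ₗ[k] (A ⊗[k] H) ⊗[k] (A ⊗[k] H) :=
  (TensorProduct.assoc k (A ⊗[k] H) A H).toLinearMap ∘ₗ
  LinearMap.rTensor H (LinearMap.lTensor (A ⊗[k] H) (LinearMap.mul' k A)) ∘ₗ
  LinearMap.rTensor H (TensorProduct.tensorTensorTensorComm k A A H A).toLinearMap ∘ₗ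
  (TensorProduct.assoc k (A ⊗[k] A) (H ⊗[k] A) H).symm.toLinearMap ∘ₗ
  LinearMap.lTensor (A ⊗[k] A) (LinearMap.rTensor H coact) ∘ₗ
  TensorProduct.map WA.comul WH.comul

/-- The smash counit `ε(x ⊗ h) = ε(x) ε(h)`. -/
def smashCounit (WH : WeakBialgebra k H) (WA : WeakBialgebra k A) :
    A ⊗[k] H →ₗ[k] k :=
  LinearMap.mul' k k ∘ₗ TensorProduct.map WA.counit WH.counit

/-- The projection `u ↦ u (1_A # 1_H)` onto `A ♯ H`. -/
def projUnder (WH : WeakBialgebra k H) (act : H →ₗ[k] A →ₗ[k] A) :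
    A ⊗[k] H →ₗ[k] A ⊗[k] H :=
  smashMul k WH act ∘ₗ
    (TensorProduct.mk k (A ⊗[k] H) (A ⊗[k] H)).flip ((1 : A) ⊗ₜ[k] (1 : H))

/-- The projection `u ↦ (id ⊗ ε) Δ(u)` onto `overline(A # H)`. -/
def projBar (WH : WeakBialgebra k H) (WA : WeakBialgebra k A)
    (coact : H →ₗ[k] H ⊗[k] A) : A ⊗[k] H →ₗ[k] A ⊗[k] H :=
  (TensorProduct.rid k (A ⊗[k] H)).toLinearMap ∘ₗ
    LinearMap.lTensor (A ⊗[k] H) (smashCounit k WH WA) ∘ₗ smashComul k WH WA coact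

/-- The projection onto `A ♯♯ H`, i.e. `u ↦ (id ⊗ ε) Δ (u (1#1))`. -/
def projBoth (WH : WeakBialgebra k H) (WA : WeakBialgebra k A)
    (act : H →ₗ[k] A →ₗ[k] A) (coact : H →ₗ[k] H ⊗[k] A) :
    A ⊗[k] H →ₗ[k] A ⊗[k] H :=
  projBar k WH WA coact ∘ₗ projUnder k WH act

/-- Componentwise smash multiplication on `(A⊗H) ⊗ (A⊗H)`. -/
def smashMul2 (WH : WeakBialgebra k H) (act : H →ₗ[k] A →ₗ[k] A) :
    ((A ⊗[k] H) ⊗[k] (A ⊗[k] H)) ⊗[k] ((A ⊗[k] H) ⊗[k] (A ⊗[k] H)) →ₗ[k]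
      (A ⊗[k] H) ⊗[k] (A ⊗[k] H) :=
  TensorProduct.map (smashMul k WH act) (smashMul k WH act) ∘ₗ
    (TensorProduct.tensorTensorTensorComm k (A ⊗[k] H) (A ⊗[k] H)
      (A ⊗[k] H) (A ⊗[k] H)).toLinearMap

/-- Componentwise smash multiplication on threefold tensors. -/
def smashMul3 (WH : WeakBialgebra k H) (act : H →ₗ[k] A →ₗ[k] A) :
    ((A ⊗[k] H) ⊗[k] ((A ⊗[k] H) ⊗[k] (A ⊗[k] H))) ⊗[k]
      ((A ⊗[k] H) ⊗[k] ((A ⊗[k] H) ⊗[k] (A ⊗[k] H))) →ₗ[k]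
      (A ⊗[k] H) ⊗[k] ((A ⊗[k] H) ⊗[k] (A ⊗[k] H)) :=
  TensorProduct.map (smashMul k WH act) (smashMul2 k WH act) ∘ₗ
    (TensorProduct.tensorTensorTensorComm k (A ⊗[k] H)
      ((A ⊗[k] H) ⊗[k] (A ⊗[k] H)) (A ⊗[k] H)
      ((A ⊗[k] H) ⊗[k] (A ⊗[k] H))).toLinearMap

/-- The unit element `1_A ♯♯ 1_H` of `A ♯♯ H`. -/
def smashOne (WH : WeakBialgebra k H) (WA : WeakBialgebra k A)
    (act : H →ₗ[k] A →ₗ[k] A) (coact : H →ₗ[k] H ⊗[k] A) : A ⊗[k] H :=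
  projBoth k WH WA act coact ((1 : A) ⊗ₜ[k] (1 : H))

/-- The map `εt` of the weak bialgebra `A ♯♯ H`: `u ↦ ε(e₁ u) e₂` where `e = 1_A ♯♯ 1_H`. -/
def smashEpsT (WH : WeakBialgebra k H) (WA : WeakBialgebra k A)
    (act : H →ₗ[k] A →ₗ[k] A) (coact : H →ₗ[k] H ⊗[k] A) (u : A ⊗[k] H) :
    A ⊗[k] H :=
  (TensorProduct.lid k (A ⊗[k] H))
    ((LinearMap.rTensor (A ⊗[k] H)
        (smashCounit k WH WA ∘ₗ smashMul k WH act ∘ₗ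
          (TensorProduct.mk k (A ⊗[k] H) (A ⊗[k] H)).flip u))
      (smashComul k WH WA coact (smashOne k WH WA act coact)))

/-- The map `εs` of the weak bialgebra `A ♯♯ H`: `u ↦ e₁ ε(u e₂)` where `e = 1_A ♯♯ 1_H`. -/
def smashEpsS (WH : WeakBialgebra k H) (WA : WeakBialgebra k A)
    (act : H →ₗ[k] A →ₗ[k] A) (coact : H →ₗ[k] H ⊗[k] A) (u : A ⊗[k] H) :
    A ⊗[k] H :=
  (TensorProduct.rid k (A ⊗[k] H))
    ((LinearMap.lTensor (A ⊗[k] H)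
        (smashCounit k WH WA ∘ₗ smashMul k WH act ∘ₗ
          TensorProduct.mk k (A ⊗[k] H) (A ⊗[k] H) u))
      (smashComul k WH WA coact (smashOne k WH WA act coact)))

/-- The antipode of `A ♯♯ H`:
`S(x ⊗ h) = (1_A ♯♯ S_H(h⁰)) ((S_A(x h¹)) ♯♯ 1_H)`. -/
def smashAntipode (WH : WeakBialgebra k H) (WA : WeakBialgebra k A)
    (act : H →ₗ[k] A →ₗ[k] A) (coact : H →ₗ[k] H ⊗[k] A)
    (SH : H →ₗ[k] H) (SA : A →ₗ[k] A) : A ⊗[k] H →ₗ[k] A ⊗[k] H :=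
  smashMul k WH act ∘ₗ
  TensorProduct.map
    (projBoth k WH WA act coact ∘ₗ TensorProduct.mk k A H 1)
    (projBoth k WH WA act coact ∘ₗ (TensorProduct.mk k A H).flip 1) ∘ₗ
  (TensorProduct.comm k A H).toLinearMap ∘ₗ
  TensorProduct.map (SA ∘ₗ LinearMap.mul' k A) SH ∘ₗ
  (TensorProduct.assoc k A A H).symm.toLinearMap ∘ₗ
  LinearMap.lTensor A ((TensorProduct.comm k H A).toLinearMap ∘ₗ coact)

/-- LHS of condition (7): `(1_{H1} h⁰ · 1_A) ⊗ S_A(h¹) εs(1_{H2}¹) ⊗ 1_{H2}⁰`. -/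
def cond7LHS (WH : WeakBialgebra k H) (WA : WeakBialgebra k A)
    (act : H →ₗ[k] A →ₗ[k] A) (coact : H →ₗ[k] H ⊗[k] A)
    (SA : A →ₗ[k] A) (h : H) : (A ⊗[k] A) ⊗[k] H :=
  (TensorProduct.assoc k A A H).symm
    ((TensorProduct.map
        (act.flip 1 ∘ₗ LinearMap.mul' k H)
        ((TensorProduct.comm k H A).toLinearMap ∘ₗ
          LinearMap.lTensor H
            (LinearMap.mul' k A ∘ₗ TensorProduct.map SA WA.εs ∘ₗ
              (TensorProduct.comm k A A).toLinearMap) ∘ₗ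
          (TensorProduct.assoc k H A A).toLinearMap ∘ₗ
          LinearMap.rTensor A coact))
      ((TensorProduct.tensorTensorTensorComm k H H H A)
        (WH.comul 1 ⊗ₜ[k] coact h)))

/-- RHS of condition (7):
`εt(1_{H1}⁰ h⁰ · 1_A) ⊗ εt(h¹) εs(1_{H2}¹) 1_{H1}¹ ⊗ 1_{H2}⁰`. -/
def cond7RHS (WH : WeakBialgebra k H) (WA : WeakBialgebra k A)
    (act : H →ₗ[k] A →ₗ[k] A) (coact : H →ₗ[k] H ⊗[k] A) (h : H) :
    (A ⊗[k] A) ⊗[k] H :=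
  (TensorProduct.assoc k A A H).symm
   ((LinearMap.lTensor A (TensorProduct.comm k H A).toLinearMap)
    ((TensorProduct.assoc k A H A)
     ((LinearMap.lTensor (A ⊗[k] H)
        (LinearMap.mul' k A ∘ₗ (TensorProduct.comm k A A).toLinearMap))
      ((TensorProduct.tensorTensorTensorComm k A A H A)
       ((LinearMap.lTensor (A ⊗[k] A) (TensorProduct.comm k A H).toLinearMap)
        ((TensorProduct.map
            (LinearMap.rTensor A (WA.εt ∘ₗ act.flip 1 ∘ₗ LinearMap.mul' k H) ∘ₗ
              (TensorProduct.assoc k H H A).symm.toLinearMap ∘ₗ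
              LinearMap.lTensor H (TensorProduct.comm k A H).toLinearMap ∘ₗ
              (TensorProduct.assoc k H A H).toLinearMap)
            (LinearMap.rTensor H
                (LinearMap.mul' k A ∘ₗ (TensorProduct.comm k A A).toLinearMap ∘ₗ
                  TensorProduct.map WA.εs WA.εt) ∘ₗ
              (TensorProduct.assoc k A A H).symm.toLinearMap ∘ₗ
              LinearMap.lTensor A (TensorProduct.comm k H A).toLinearMap ∘ₗ
              (TensorProduct.assoc k A H A).toLinearMap ∘ₗ
              LinearMap.rTensor A (TensorProduct.comm k H A).toLinearMap))
          ((TensorProduct.tensorTensorTensorComm k (H ⊗[k] A) (H ⊗[k] A) H A)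
            (((TensorProduct.map coact coact) (WH.comul 1)) ⊗ₜ[k] coact h))))))))

/-- LHS of condition (8):
`εs(h₁¹ h₂¹) (S_H(h₁⁰) · 1_A) ⊗ S_H(h₂⁰) h₃`. -/
def cond8LHS (WH : WeakBialgebra k H) (WA : WeakBialgebra k A)
    (act : H →ₗ[k] A →ₗ[k] A) (coact : H →ₗ[k] H ⊗[k] A)
    (SH : H →ₗ[k] H) (h : H) : A ⊗[k] H :=
  LinearMap.rTensor H (LinearMap.mul' k A)
   ((TensorProduct.assoc k A A H).symm
    ((TensorProduct.map
        (WA.εs ∘ₗ LinearMap.mul' k A)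
        (TensorProduct.map (act.flip 1 ∘ₗ SH)
          (LinearMap.mul' k H ∘ₗ LinearMap.rTensor H SH)))
      ((TensorProduct.tensorTensorTensorComm k A H A (H ⊗[k] H))
        ((TensorProduct.map (TensorProduct.comm k H A).toLinearMap
            ((TensorProduct.assoc k A H H).toLinearMap ∘ₗ
              LinearMap.rTensor H (TensorProduct.comm k H A).toLinearMap))
          ((TensorProduct.map coact (LinearMap.rTensor H coact))
            (twoComul k WH h))))))

/-- RHS of condition (8):
`εs(h¹ 1_{H2}¹) εs(h⁰ 1_{H1} · 1_A) ⊗ 1_{H2}⁰`. -/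
def cond8RHS (WH : WeakBialgebra k H) (WA : WeakBialgebra k A)
    (act : H →ₗ[k] A →ₗ[k] A) (coact : H →ₗ[k] H ⊗[k] A) (h : H) :
    A ⊗[k] H :=
  LinearMap.rTensor H (LinearMap.mul' k A ∘ₗ (TensorProduct.comm k A A).toLinearMap)
   ((TensorProduct.assoc k A A H).symm
    ((TensorProduct.map
        (WA.εs ∘ₗ act.flip 1 ∘ₗ LinearMap.mul' k H)
        (LinearMap.rTensor H (WA.εs ∘ₗ LinearMap.mul' k A) ∘ₗ
          (TensorProduct.assoc k A A H).symm.toLinearMap ∘ₗ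
          LinearMap.lTensor A (TensorProduct.comm k H A).toLinearMap))
      ((TensorProduct.tensorTensorTensorComm k H A H (H ⊗[k] A))
        (coact h ⊗ₜ[k] (LinearMap.lTensor H coact) (WH.comul 1)))))

/-- The element `εs(t₁¹ (t₂ · 1_A)) ⊗ t₁⁰` of `A ⊗ H`. -/
def integralWitness (WH : WeakBialgebra k H) (WA : WeakBialgebra k A)
    (act : H →ₗ[k] A →ₗ[k] A) (coact : H →ₗ[k] H ⊗[k] A) (t : H) :
    A ⊗[k] H :=
  (TensorProduct.comm k H A)
    ((LinearMap.lTensor H (WA.εs ∘ₗ LinearMap.mul' k A))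
      ((TensorProduct.assoc k H A A)
        ((LinearMap.rTensor A coact)
          ((LinearMap.lTensor H (act.flip 1)) (WH.comul t)))))

end MatchedPair

end WeakSmash


namespace WeakSmash

section

variable {k H A : Type*} [Field k] [Ring H] [Algebra k H] [Ring A] [Algebra k A]

namespace WeakBialgebra

/-- The map `h ↦ h₁ ⊗ l h₂`. -/
def comulRight (WH : WeakBialgebra k H) {M : Type*} [AddCommGroup M] [Module k M]
    (l : H →ₗ[k] M) : H →ₗ[k] H ⊗[k] M :=
  LinearMap.lTensor H l ∘ₗ WH.comul

theorem assoc_map_comulRight (WH : WeakBialgebra k H) {M N : Type*}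
    [AddCommGroup M] [Module k M] [AddCommGroup N] [Module k N]
    (l : H →ₗ[k] M) (r : H →ₗ[k] N) (h : H) :
    TensorProduct.assoc k H M N (TensorProduct.map (WH.comulRight l) r (WH.comul h)) =
      WH.comulRight (TensorProduct.map l r ∘ₗ WH.comul) h := by
  have key : ∀ U : (H ⊗[k] H) ⊗[k] H,
      TensorProduct.assoc k H M N (TensorProduct.map (LinearMap.lTensor H l) r U) =
        LinearMap.lTensor H (TensorProduct.map l r) (TensorProduct.assoc k H H H U) := by
    intro U
    induction U with
    | zero => simp
    | add a b ha hb => simp only [map_add, ha, hb]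
    | tmul U c =>
      induction U with
      | zero => simp
      | add a b ha hb => simp only [TensorProduct.add_tmul, map_add, ha, hb]
      | tmul a b => simp
  have h1 : TensorProduct.map (WH.comulRight l) r (WH.comul h) =
      TensorProduct.map (LinearMap.lTensor H l) r
        (LinearMap.rTensor H WH.comul (WH.comul h)) := by
    rw [← LinearMap.comp_apply (TensorProduct.map (LinearMap.lTensor H l) r),
      LinearMap.map_comp_rTensor]
    rfl
  rw [h1, key, WH.coassoc, comulRight, LinearMap.lTensor_comp]
  rfl

theorem assoc_map_comul (WH : WeakBialgebra k H) {N : Type*}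
    [AddCommGroup N] [Module k N] (r : H →ₗ[k] N) (h : H) :
    TensorProduct.assoc k H H N (TensorProduct.map WH.comul r (WH.comul h)) =
      WH.comulRight (WH.comulRight r) h := by
  simpa [comulRight, LinearMap.lTensor] using WH.assoc_map_comulRight LinearMap.id r h

theorem Cocomm.leftComm_comulRight {WH : WeakBialgebra k H} (hcoc : WH.Cocomm) {N : Type*}
    [AddCommGroup N] [Module k N] (r : H →ₗ[k] N) (h : H) :
    TensorProduct.leftComm k H H N (WH.comulRight (WH.comulRight r) h) =
      WH.comulRight (WH.comulRight r) h := by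
  have key : ∀ U : (H ⊗[k] H) ⊗[k] N,
      TensorProduct.leftComm k H H N (TensorProduct.assoc k H H N U) =
        TensorProduct.assoc k H H N
          (LinearMap.rTensor N (TensorProduct.comm k H H).toLinearMap U) := by
    intro U
    induction U with
    | zero => simp
    | add a b ha hb => simp only [map_add, ha, hb]
    | tmul U c =>
      induction U with
      | zero => simp
      | add a b ha hb => simp only [TensorProduct.add_tmul, map_add, ha, hb]
      | tmul a b => simp
  have hc : (TensorProduct.comm k H H).toLinearMap ∘ₗ WH.comul = WH.comul :=
    LinearMap.ext hcoc
  rw [← WH.assoc_map_comul, key, ← LinearMap.comp_apply, LinearMap.rTensor_comp_map, hc]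

/-- The iterated comultiplication `h ↦ h₁ ⊗ (h₂ ⊗ (h₃ ⊗ (h₄ ⊗ h₅)))`. -/
def fourComul (WH : WeakBialgebra k H) :
    H →ₗ[k] H ⊗[k] (H ⊗[k] (H ⊗[k] (H ⊗[k] H))) :=
  WH.comulRight (WH.comulRight (WH.comulRight WH.comul))

theorem Cocomm.lTensor_leftComm_fourComul {WH : WeakBialgebra k H} (hcoc : WH.Cocomm) (h : H) :
    LinearMap.lTensor H (TensorProduct.leftComm k H H (H ⊗[k] H)).toLinearMap
      (WH.fourComul h) = WH.fourComul h := by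
  have hc : (TensorProduct.leftComm k H H (H ⊗[k] H)).toLinearMap ∘ₗ
      WH.comulRight (WH.comulRight WH.comul) = WH.comulRight (WH.comulRight WH.comul) :=
    LinearMap.ext (hcoc.leftComm_comulRight _)
  rw [fourComul]
  nth_rewrite 1 [comulRight]
  rw [LinearMap.comp_apply, ← LinearMap.comp_apply, ← LinearMap.lTensor_comp, hc]
  rfl

/-- The rebracketing `((a ⊗ b) ⊗ (c ⊗ d)) ⊗ e ↦ a ⊗ (b ⊗ (c ⊗ (d ⊗ e)))`. -/
def rebracketPairs :
    ((H ⊗[k] H) ⊗[k] (H ⊗[k] H)) ⊗[k] H ≃ₗ[k] H ⊗[k] (H ⊗[k] (H ⊗[k] (H ⊗[k] H))) :=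
  TensorProduct.assoc k (H ⊗[k] H) (H ⊗[k] H) H ≪≫ₗ
    TensorProduct.assoc k H H ((H ⊗[k] H) ⊗[k] H) ≪≫ₗ
    LinearEquiv.lTensor H (LinearEquiv.lTensor H (TensorProduct.assoc k H H H))

/-- The rebracketing `(a ⊗ b) ⊗ ((c ⊗ d) ⊗ e) ↦ a ⊗ (b ⊗ (c ⊗ (d ⊗ e)))`. -/
def rebracketPairTriple :
    (H ⊗[k] H) ⊗[k] ((H ⊗[k] H) ⊗[k] H) ≃ₗ[k] H ⊗[k] (H ⊗[k] (H ⊗[k] (H ⊗[k] H))) :=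
  TensorProduct.assoc k H H ((H ⊗[k] H) ⊗[k] H) ≪≫ₗ
    LinearEquiv.lTensor H (LinearEquiv.lTensor H (TensorProduct.assoc k H H H))

theorem rebracketPairTriple_comul (WH : WeakBialgebra k H) (h : H) :
    rebracketPairTriple
      (TensorProduct.map WH.comul (LinearMap.rTensor H WH.comul ∘ₗ WH.comul) (WH.comul h)) =
      WH.fourComul h := by
  have hc : (TensorProduct.assoc k H H H).toLinearMap ∘ₗ
      (LinearMap.rTensor H WH.comul ∘ₗ WH.comul) = WH.comulRight WH.comul :=
    LinearMap.ext WH.coassoc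
  rw [rebracketPairTriple, LinearEquiv.trans_apply, WH.assoc_map_comul, fourComul, ← hc]
  simp only [comulRight, LinearMap.lTensor_comp]
  rfl

theorem rebracketPairs_threeComul (WH : WeakBialgebra k H) (h : H) :
    rebracketPairs
      (LinearMap.rTensor H
        ((TensorProduct.assoc k H H (H ⊗[k] H)).symm.toLinearMap ∘ₗ threeComul k WH)
        (WH.comul h)) = WH.fourComul h := by
  have h3 : threeComul k WH = WH.comulRight (WH.comulRight WH.comul) := by
    simp only [threeComul, comulRight, LinearMap.lTensor_comp]
    rfl
  have key : ∀ U : (H ⊗[k] (H ⊗[k] (H ⊗[k] H))) ⊗[k] H,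
      rebracketPairs (LinearMap.rTensor H
        (TensorProduct.assoc k H H (H ⊗[k] H)).symm.toLinearMap U) =
      LinearMap.lTensor H (LinearMap.lTensor H (TensorProduct.assoc k H H H).toLinearMap)
        (LinearMap.lTensor H (TensorProduct.assoc k H (H ⊗[k] H) H).toLinearMap
          (TensorProduct.assoc k H (H ⊗[k] (H ⊗[k] H)) H U)) := by
    intro U
    induction U with
    | zero => simp
    | add a b ha hb => simp only [map_add, ha, hb]
    | tmul U e =>
      induction U with
      | zero => simp
      | add a b ha hb => simp only [TensorProduct.add_tmul, map_add, ha, hb]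
      | tmul a U =>
        induction U with
        | zero => simp
        | add a b ha hb =>
          simp only [TensorProduct.tmul_add, TensorProduct.add_tmul, map_add, ha, hb]
        | tmul b c => simp [rebracketPairs]
  have e1 : (TensorProduct.assoc k H H H).toLinearMap ∘ₗ
      (TensorProduct.map WH.comul LinearMap.id ∘ₗ WH.comul) = WH.comulRight WH.comul :=
    LinearMap.ext WH.coassoc
  have e2 : LinearMap.lTensor H (TensorProduct.assoc k H (H ⊗[k] H) H).toLinearMap
      (WH.comulRight (M := (H ⊗[k] (H ⊗[k] H)) ⊗[k] H)
        (TensorProduct.map (WH.comulRight WH.comul) LinearMap.id ∘ₗ WH.comul) h) =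
      WH.comulRight (WH.comulRight (TensorProduct.map WH.comul LinearMap.id ∘ₗ WH.comul)) h := by
    rw [comulRight, LinearMap.comp_apply, ← LinearMap.comp_apply (LinearMap.lTensor H _),
      ← LinearMap.lTensor_comp]
    exact congrArg (fun l => LinearMap.lTensor H l (WH.comul h))
      (LinearMap.ext (WH.assoc_map_comulRight _ _))
  rw [LinearMap.rTensor_comp, LinearMap.comp_apply, key, h3, LinearMap.rTensor,
    WH.assoc_map_comulRight, e2, fourComul, ← e1]
  simp only [comulRight, LinearMap.lTensor_comp]
  rfl

end WeakBialgebra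

/-- The map `((a ⊗ u) ⊗ b) ⊗ v ↦ (x₁ a ⊗ u) ⊗ (x₂ b ⊗ v g₂)`. -/
def smashAssemble (x₁ x₂ : A) (g₂ : H) :
    ((A ⊗[k] H) ⊗[k] A) ⊗[k] H →ₗ[k] (A ⊗[k] H) ⊗[k] (A ⊗[k] H) :=
  (TensorProduct.assoc k (A ⊗[k] H) A H).toLinearMap ∘ₗ
    TensorProduct.map
      (TensorProduct.map (LinearMap.rTensor H (LinearMap.mulLeft k x₁)) (LinearMap.mulLeft k x₂))
      (LinearMap.mulRight k g₂)

/-- The part of `smashComul` following the two comultiplications: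
`(x₁ ⊗ x₂) ⊗ (h₁ ⊗ h₂) ↦ (x₁ ⊗ h₁⁰) ⊗ (x₂ h₁¹ ⊗ h₂)`. -/
def smashSplit (coact : H →ₗ[k] H ⊗[k] A) :
    (A ⊗[k] A) ⊗[k] (H ⊗[k] H) →ₗ[k] (A ⊗[k] H) ⊗[k] (A ⊗[k] H) :=
  (TensorProduct.assoc k (A ⊗[k] H) A H).toLinearMap ∘ₗ
  LinearMap.rTensor H (LinearMap.lTensor (A ⊗[k] H) (LinearMap.mul' k A)) ∘ₗ
  LinearMap.rTensor H (TensorProduct.tensorTensorTensorComm k A A H A).toLinearMap ∘ₗ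
  (TensorProduct.assoc k (A ⊗[k] A) (H ⊗[k] A) H).symm.toLinearMap ∘ₗ
  LinearMap.lTensor (A ⊗[k] A) (LinearMap.rTensor H coact)

theorem smashComul_tmul (WH : WeakBialgebra k H) (WA : WeakBialgebra k A)
    (coact : H →ₗ[k] H ⊗[k] A) (x : A) (h : H) :
    smashComul k WH WA coact (x ⊗ₜ[k] h) = smashSplit coact (WA.comul x ⊗ₜ[k] WH.comul h) := rfl

theorem smashMul_tmul (WH : WeakBialgebra k H) (act : H →ₗ[k] A →ₗ[k] A)
    (x y : A) (h g : H) :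
    smashMul k WH act ((x ⊗ₜ[k] h) ⊗ₜ[k] (y ⊗ₜ[k] g)) =
      TensorProduct.map (LinearMap.mulLeft k x ∘ₗ act.flip y) (LinearMap.mulRight k g)
        (WH.comul h) := by
  simp only [smashMul, LinearMap.comp_apply, LinearMap.rTensor_tmul, LinearMap.lTensor_tmul,
    LinearEquiv.coe_coe, TensorProduct.assoc_tmul]
  induction WH.comul h with
  | zero => simp
  | add a b ha hb => simp only [TensorProduct.add_tmul, TensorProduct.tmul_add, map_add, ha, hb]
  | tmul a b => simp

/-- `mpLHS` as a linear map in `h`. -/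
def mpLHSLin (WH : WeakBialgebra k H) (WA : WeakBialgebra k A)
    (act : H →ₗ[k] A →ₗ[k] A) (coact : H →ₗ[k] H ⊗[k] A) (g : H) (x : A) :
    H →ₗ[k] (A ⊗[k] H) ⊗[k] A :=
  LinearMap.lTensor (A ⊗[k] H) (LinearMap.mul' k A) ∘ₗ
    (TensorProduct.tensorTensorTensorComm k A A H A).toLinearMap ∘ₗ
      TensorProduct.map (WA.comul ∘ₗ act.flip x) (coact ∘ₗ LinearMap.mulRight k g) ∘ₗ WH.comul

/-- The map on iterated coproducts underlying `mpRHS`, in terms of `x₁ ⊗ x₂` and `g⁰ ⊗ g¹`. -/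
def mpRHSPre (act : H →ₗ[k] A →ₗ[k] A) (coact : H →ₗ[k] H ⊗[k] A)
    (W : H ⊗[k] A) (Y : A ⊗[k] A) :
    (H ⊗[k] H) ⊗[k] (H ⊗[k] H) →ₗ[k] (A ⊗[k] H) ⊗[k] A :=
  LinearMap.lTensor (A ⊗[k] H) (LinearMap.mul' k A) ∘ₗ
    (TensorProduct.tensorTensorTensorComm k A A H A).toLinearMap ∘ₗ
      TensorProduct.map
        (pairMapA k act coact ∘ₗ (TensorProduct.mk k (H ⊗[k] H) (A ⊗[k] A)).flip Y)
        (pairMapH k act coact ∘ₗ (TensorProduct.mk k (H ⊗[k] H) (H ⊗[k] A)).flip W)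

theorem IsWeakMatchedPair.mpLHSLin_eq {WH : WeakBialgebra k H} {WA : WeakBialgebra k A}
    {act : H →ₗ[k] A →ₗ[k] A} {coact : H →ₗ[k] H ⊗[k] A}
    (hMP : IsWeakMatchedPair k WH WA act coact) (g : H) (x : A) :
    mpLHSLin WH WA act coact g x =
      mpRHSPre act coact (coact g) (WA.comul x) ∘ₗ
        ((TensorProduct.assoc k H H (H ⊗[k] H)).symm.toLinearMap ∘ₗ threeComul k WH) :=
  LinearMap.ext fun h => hMP.cond3 h g x

/-- The map `U ↦ smashSplit ((x₁ ⊗ x₂) Δ(h₁ · y) ⊗ Δ(h₂) (g₁ ⊗ g₂))`, for `U = h₁ ⊗ h₂`. -/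
def smashSplitMul (WH : WeakBialgebra k H) (WA : WeakBialgebra k A)
    (act : H →ₗ[k] A →ₗ[k] A) (coact : H →ₗ[k] H ⊗[k] A) (y : A)
    (X : A ⊗[k] A) (G : H ⊗[k] H) : H ⊗[k] H →ₗ[k] (A ⊗[k] H) ⊗[k] (A ⊗[k] H) :=
  smashSplit coact ∘ₗ
    TensorProduct.map (LinearMap.mulLeft k X ∘ₗ WA.comul ∘ₗ act.flip y)
      (LinearMap.mulRight k G ∘ₗ WH.comul)

theorem smashComul_smashMul (WH : WeakBialgebra k H) (WA : WeakBialgebra k A)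
    (act : H →ₗ[k] A →ₗ[k] A) (coact : H →ₗ[k] H ⊗[k] A) (x y : A) (h g : H) :
    smashComul k WH WA coact (smashMul k WH act ((x ⊗ₜ[k] h) ⊗ₜ[k] (y ⊗ₜ[k] g))) =
      smashSplitMul WH WA act coact y (WA.comul x) (WH.comul g) (WH.comul h) := by
  rw [smashMul_tmul]
  induction WH.comul h with
  | zero => simp
  | add a b ha hb => simp only [map_add, ha, hb]
  | tmul a b => simp [smashSplitMul, smashComul_tmul, WA.comul_mul, WH.comul_mul]

set_option maxHeartbeats 1000000 in
theorem smashSplitMul_tmul_comul (WH : WeakBialgebra k H) (WA : WeakBialgebra k A)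
    (act : H →ₗ[k] A →ₗ[k] A) (coact : H →ₗ[k] H ⊗[k] A) (x₁ x₂ y : A) (h g₁ g₂ : H) :
    smashSplitMul WH WA act coact y (x₁ ⊗ₜ[k] x₂) (g₁ ⊗ₜ[k] g₂) (WH.comul h) =
      smashAssemble x₁ x₂ g₂
        (LinearMap.rTensor H (mpLHSLin WH WA act coact g₁ y) (WH.comul h)) := by
  have left : ∀ U : H ⊗[k] H,
      smashSplitMul WH WA act coact y (x₁ ⊗ₜ[k] x₂) (g₁ ⊗ₜ[k] g₂) U =
        (smashSplit coact ∘ₗ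
          TensorProduct.map (LinearMap.mulLeft k (x₁ ⊗ₜ[k] x₂) ∘ₗ WA.comul ∘ₗ act.flip y)
            (LinearMap.mulRight k (g₁ ⊗ₜ[k] g₂))) (LinearMap.lTensor H WH.comul U) := by
    intro U
    induction U with
    | zero => simp only [map_zero]
    | add a b ha hb => simp only [map_add, ha, hb]
    | tmul a b => simp [smashSplitMul]
  rw [left, ← WH.coassoc]
  induction WH.comul h with
  | zero => simp only [map_zero]
  | add a b ha hb => simp only [map_add, ha, hb]
  | tmul p q =>
    simp only [LinearMap.rTensor_tmul, mpLHSLin, LinearMap.comp_apply]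
    induction WH.comul p with
    | zero => simp only [TensorProduct.zero_tmul, map_zero]
    | add a b ha hb => simp only [TensorProduct.add_tmul, map_add, ha, hb]
    | tmul a b =>
      simp only [smashSplit, LinearMap.comp_apply, LinearEquiv.coe_coe, TensorProduct.assoc_tmul,
        TensorProduct.map_tmul, LinearMap.mulRight_apply, LinearMap.mulLeft_apply,
        Algebra.TensorProduct.tmul_mul_tmul, LinearMap.lTensor_tmul, LinearMap.rTensor_tmul]
      induction WA.comul (act.flip y a) with
      | zero => simp only [mul_zero, TensorProduct.zero_tmul, map_zero]
      | add a b ha hb => simp only [mul_add, TensorProduct.add_tmul, map_add, ha, hb]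
      | tmul z₁ z₂ =>
        induction coact (b * g₁) with
        | zero => simp only [TensorProduct.zero_tmul, TensorProduct.tmul_zero, map_zero]
        | add a b ha hb =>
          simp only [TensorProduct.tmul_add, TensorProduct.add_tmul, map_add, ha, hb]
        | tmul w₁ w₂ => simp [smashAssemble, mul_assoc]

/-- The map sending `(a ⊗ c) ⊗ ((b ⊗ d) ⊗ e)` to
`(x₁ (a⁰ · y₁) ⊗ c⁰ w) ⊗ (x₂ a¹ c¹ (b · y₂) (d · v) ⊗ e g₂)`. -/
def smashProductPre (act : H →ₗ[k] A →ₗ[k] A) (coact : H →ₗ[k] H ⊗[k] A)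
    (x₁ x₂ y₁ y₂ v : A) (w g₂ : H) :
    (H ⊗[k] H) ⊗[k] ((H ⊗[k] H) ⊗[k] H) →ₗ[k] (A ⊗[k] H) ⊗[k] (A ⊗[k] H) :=
  LinearMap.lTensor (A ⊗[k] H) (LinearMap.rTensor H (LinearMap.mul' k A) ∘ₗ
      (TensorProduct.assoc k A A H).symm.toLinearMap) ∘ₗ
    (TensorProduct.assoc k (A ⊗[k] H) A (A ⊗[k] H)).toLinearMap ∘ₗ
    TensorProduct.map
      (TensorProduct.map
        (TensorProduct.map (LinearMap.mulLeft k x₁ ∘ₗ act.flip y₁) (LinearMap.mulRight k w))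
        (LinearMap.mulLeft k x₂))
      (LinearMap.lTensor A (LinearMap.mulRight k g₂)) ∘ₗ
    TensorProduct.map
      (LinearMap.lTensor (H ⊗[k] H) (LinearMap.mul' k A) ∘ₗ
        (TensorProduct.tensorTensorTensorComm k H A H A).toLinearMap ∘ₗ
        TensorProduct.map coact coact)
      (LinearMap.rTensor H
        (LinearMap.mul' k A ∘ₗ TensorProduct.map (act.flip y₂) (act.flip v)))

theorem IsWeakMatchedPair.smashMul2_smashSplit {WH : WeakBialgebra k H} {WA : WeakBialgebra k A}
    {act : H →ₗ[k] A →ₗ[k] A} {coact : H →ₗ[k] H ⊗[k] A}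
    (hMP : IsWeakMatchedPair k WH WA act coact) (x₁ x₂ y₁ y₂ v : A) (w g₂ : H) (U : H ⊗[k] H) :
    smashMul2 k WH act
        (smashSplit coact ((x₁ ⊗ₜ[k] x₂) ⊗ₜ[k] U) ⊗ₜ[k]
          ((y₁ ⊗ₜ[k] w) ⊗ₜ[k] ((y₂ * v) ⊗ₜ[k] g₂))) =
      smashProductPre act coact x₁ x₂ y₁ y₂ v w g₂
        (TensorProduct.map WH.comul (LinearMap.rTensor H WH.comul ∘ₗ WH.comul) U) := by
  induction U with
  | zero => simp only [TensorProduct.zero_tmul, TensorProduct.tmul_zero, map_zero]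
  | add a b ha hb => simp only [TensorProduct.tmul_add, TensorProduct.add_tmul, map_add, ha, hb]
  | tmul p q =>
    have hact : (LinearMap.mul' k A ∘ₗ TensorProduct.map (act.flip y₂) (act.flip v)) ∘ₗ WH.comul =
        act.flip (y₂ * v) := LinearMap.ext fun h => (hMP.moduleAlgebra.act_mul h y₂ v).symm
    simp only [smashProductPre, LinearMap.comp_apply, LinearEquiv.coe_coe,
      TensorProduct.map_tmul]
    rw [← hMP.comoduleCoalgebra.comul_coact p, ← LinearMap.comp_apply (LinearMap.rTensor H _),
      ← LinearMap.rTensor_comp, hact]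
    simp only [smashSplit, smashMul2, LinearMap.comp_apply, LinearEquiv.coe_coe,
      LinearMap.lTensor_tmul, LinearMap.rTensor_tmul, TensorProduct.assoc_symm_tmul]
    induction coact p with
    | zero => simp only [TensorProduct.zero_tmul, TensorProduct.tmul_zero, map_zero]
    | add a b ha hb =>
      simp only [TensorProduct.tmul_add, TensorProduct.add_tmul, map_add, ha, hb]
    | tmul p₀ p₁ =>
      simp only [TensorProduct.tensorTensorTensorComm_tmul, LinearMap.lTensor_tmul,
        LinearMap.rTensor_tmul, TensorProduct.assoc_tmul, TensorProduct.map_tmul,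
        smashMul_tmul, LinearMap.mul'_apply]
      induction WH.comul p₀ with
      | zero => simp only [TensorProduct.zero_tmul, map_zero]
      | add a b ha hb =>
        simp only [TensorProduct.add_tmul, map_add, ha, hb]
      | tmul a c =>
        induction WH.comul q with
        | zero => simp only [TensorProduct.tmul_zero, map_zero]
        | add a b ha hb =>
          simp only [TensorProduct.tmul_add, map_add, ha, hb]
        | tmul b e => simp [mul_assoc]

theorem smashAssemble_mpRHSPre (hcomm : ∀ a b : A, a * b = b * a)
    (act : H →ₗ[k] A →ₗ[k] A) (coact : H →ₗ[k] H ⊗[k] A)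
    (x₁ x₂ y₁ y₂ v : A) (w g₂ : H) (n : H ⊗[k] (H ⊗[k] (H ⊗[k] (H ⊗[k] H)))) :
    smashAssemble x₁ x₂ g₂
        (LinearMap.rTensor H (mpRHSPre act coact (w ⊗ₜ[k] v) (y₁ ⊗ₜ[k] y₂))
          (WeakBialgebra.rebracketPairs.symm n)) =
      smashProductPre act coact x₁ x₂ y₁ y₂ v w g₂
        (WeakBialgebra.rebracketPairTriple.symm
          (LinearMap.lTensor H (TensorProduct.leftComm k H H (H ⊗[k] H)).toLinearMap n)) := by
  induction n with
  | zero => simp only [map_zero]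
  | add a b ha hb => simp only [map_add, ha, hb]
  | tmul a n =>
  induction n with
  | zero => simp only [TensorProduct.tmul_zero, map_zero]
  | add a b ha hb => simp only [TensorProduct.tmul_add, map_add, ha, hb]
  | tmul b n =>
  induction n with
  | zero => simp only [TensorProduct.tmul_zero, map_zero]
  | add a b ha hb => simp only [TensorProduct.tmul_add, map_add, ha, hb]
  | tmul c n =>
  induction n with
  | zero => simp only [TensorProduct.tmul_zero, map_zero]
  | add a b ha hb => simp only [TensorProduct.tmul_add, map_add, ha, hb]
  | tmul d e =>
  have h1 : WeakBialgebra.rebracketPairs.symm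
      (a ⊗ₜ[k] (b ⊗ₜ[k] (c ⊗ₜ[k] (d ⊗ₜ[k] e)))) = ((a ⊗ₜ b) ⊗ₜ (c ⊗ₜ d)) ⊗ₜ e := by
    simp [WeakBialgebra.rebracketPairs]
  have h2 : WeakBialgebra.rebracketPairTriple.symm
      (a ⊗ₜ[k] (c ⊗ₜ[k] (b ⊗ₜ[k] (d ⊗ₜ[k] e)))) = (a ⊗ₜ c) ⊗ₜ ((b ⊗ₜ d) ⊗ₜ e) := by
    simp [WeakBialgebra.rebracketPairTriple]
  rw [LinearMap.lTensor_tmul, LinearEquiv.coe_coe, TensorProduct.leftComm_tmul, h1, h2]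
  simp only [mpRHSPre, pairMapA, pairMapH, smashProductPre, LinearMap.comp_apply,
    LinearMap.rTensor_tmul, TensorProduct.map_tmul, LinearMap.flip_apply,
    TensorProduct.mk_apply, LinearEquiv.coe_coe, TensorProduct.tensorTensorTensorComm_tmul]
  induction coact a with
  | zero => simp only [TensorProduct.zero_tmul, map_zero]
  | add a b ha hb => simp only [TensorProduct.add_tmul, map_add, ha, hb]
  | tmul a₀ a₁ =>
  induction coact c with
  | zero => simp only [TensorProduct.zero_tmul, TensorProduct.tmul_zero, map_zero]
  | add a b ha hb => simp only [TensorProduct.add_tmul, TensorProduct.tmul_add, map_add, ha, hb]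
  | tmul c₀ c₁ =>
  have hA : a₁ * act b y₂ * (c₁ * act d v) = a₁ * c₁ * (act b y₂ * act d v) := by
    rw [mul_assoc, mul_assoc, ← mul_assoc (act b y₂), hcomm (act b y₂), mul_assoc]
  simp [smashAssemble, hA, mul_assoc]

end

theorem smashComul_multiplicative
    {k H A : Type*} [Field k] [Ring H] [Algebra k H] [Ring A] [Algebra k A]
    (WH : WeakBialgebra k H) (WA : WeakBialgebra k A)
    (act : H →ₗ[k] A →ₗ[k] A) (coact : H →ₗ[k] H ⊗[k] A)
    (hMP : IsWeakMatchedPair k WH WA act coact)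
    (hcoc : WH.Cocomm) (hcomm : ∀ a b : A, a * b = b * a) :
    ∀ (x y : A) (h g : H),
      smashComul k WH WA coact (smashMul k WH act ((x ⊗ₜ[k] h) ⊗ₜ[k] (y ⊗ₜ[k] g))) =
        smashMul2 k WH act
          (smashComul k WH WA coact (x ⊗ₜ[k] h) ⊗ₜ[k] smashComul k WH WA coact (y ⊗ₜ[k] g)) := by
  intro x y h g
  rw [smashComul_smashMul, smashComul_tmul, smashComul_tmul]
  induction WA.comul x with
  | zero => simp [smashSplitMul]
  | add a b ha hb =>
    simp only [TensorProduct.add_tmul, map_add, ← ha, ← hb]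
    induction WH.comul h with
    | zero => simp
    | add p q hp hq =>
      simp only [map_add, hp, hq]
      abel
    | tmul p q => simp [smashSplitMul, add_mul, TensorProduct.add_tmul]
  | tmul x₁ x₂ =>
  induction WH.comul g with
  | zero => simp [smashSplitMul]
  | add a b ha hb =>
    simp only [TensorProduct.tmul_add, map_add, ← ha, ← hb]
    induction WH.comul h with
    | zero => simp
    | add p q hp hq =>
      simp only [map_add, hp, hq]
      abel
    | tmul p q => simp [smashSplitMul, mul_add, TensorProduct.tmul_add]
  | tmul g₁ g₂ =>
  rw [smashSplitMul_tmul_comul, hMP.mpLHSLin_eq, LinearMap.rTensor_comp, LinearMap.comp_apply,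
    ← LinearEquiv.symm_apply_eq _ |>.mpr (WH.rebracketPairs_threeComul h).symm]
  have hsplit : ∀ Y : A ⊗[k] A, smashSplit coact (Y ⊗ₜ[k] (g₁ ⊗ₜ[k] g₂)) =
      (TensorProduct.assoc k (A ⊗[k] H) A H)
        (LinearMap.lTensor (A ⊗[k] H) (LinearMap.mul' k A)
          (TensorProduct.tensorTensorTensorComm k A A H A (Y ⊗ₜ[k] coact g₁)) ⊗ₜ[k] g₂) :=
    fun Y => by simp [smashSplit]
  rw [hsplit]
  induction WA.comul y with
  | zero => simp [mpRHSPre, LinearMap.comp_zero]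
  | add a b ha hb =>
    have hadd : mpRHSPre act coact (coact g₁) (a + b) =
        mpRHSPre act coact (coact g₁) a + mpRHSPre act coact (coact g₁) b := by
      simp only [mpRHSPre, map_add, LinearMap.comp_add, TensorProduct.map_add_left]
    simp only [hadd, LinearMap.rTensor_add, LinearMap.add_apply, map_add, ha, hb,
      TensorProduct.add_tmul, TensorProduct.tmul_add]
  | tmul y₁ y₂ =>
  induction coact g₁ with
  | zero => simp [mpRHSPre, LinearMap.comp_zero]
  | add a b ha hb =>
    have hadd : mpRHSPre act coact (a + b) (y₁ ⊗ₜ[k] y₂) =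
        mpRHSPre act coact a (y₁ ⊗ₜ[k] y₂) + mpRHSPre act coact b (y₁ ⊗ₜ[k] y₂) := by
      simp only [mpRHSPre, map_add, LinearMap.comp_add, TensorProduct.map_add_right]
    simp only [hadd, LinearMap.rTensor_add, LinearMap.add_apply, map_add, ha, hb,
      TensorProduct.add_tmul, TensorProduct.tmul_add]
  | tmul w v =>
  rw [smashAssemble_mpRHSPre hcomm, hcoc.lTensor_leftComm_fourComul,
    LinearEquiv.symm_apply_eq _ |>.mpr (WH.rebracketPairTriple_comul h).symm,
    ← hMP.smashMul2_smashSplit]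
  simp

end WeakSmash
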